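/- arXiv:1006.5655 — 3 statements merged into one kernel-verified Lean document; each statement's English description precedes it below -/
import Mathlib

section
/- Let G : (0, ∞) → [0, ∞) be nonincreasing, and assume there exist α > 0, c > 0 and a slowly varying function L̃ such that, with b_n = n^{1/α} L̃(n), n·G(b_n x) → c·x^{−α} as n → ∞ for every x > 0. Then G is regularly varying of index −α at infinity, i.e., for every λ > 0, G(λx)/G(x) → λ^{−α} as x → ∞. -/
open Filter Topology

/-- if `n * G(bₙ x) → c x^{-α}` with `bₙ = n^{1/α} L̃(n)` for a slowly
varying `L̃`, then the nonincreasing function `G` is regularly varying of index `-α`. -/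
theorem tail_is_regularly_varying
    (G : ℝ → ℝ) (hGnonneg : ∀ x > 0, 0 ≤ G x)
    (hGanti : AntitoneOn G (Set.Ioi 0))
    (α c : ℝ) (hα : 0 < α) (hc : 0 < c)
    (L : ℝ → ℝ) (hLpos : ∀ x > 0, 0 < L x)
    (hL : ∀ lam > 0, Tendsto (fun x => L (lam * x) / L x) atTop (𝓝 1))
    (b : ℕ → ℝ) (hb : ∀ n : ℕ, b n = (n : ℝ) ^ (1 / α) * L n)
    (hG : ∀ x > 0, Tendsto (fun n : ℕ => (n : ℝ) * G (b n * x)) atTop (𝓝 (c * x ^ (-α)))) :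
    ∀ lam > 0, Tendsto (fun x => G (lam * x) / G x) atTop (𝓝 (lam ^ (-α))) := by
  have hbpos : ∀ n : ℕ, 1 ≤ n → 0 < b n := by
    intro n hn
    have hn' : (0 : ℝ) < n := by exact_mod_cast hn
    rw [hb]
    exact mul_pos (Real.rpow_pos_of_pos hn' _) (hLpos _ hn')
  have hlim_pos : ∀ x > 0, 0 < c * x ^ (-α) := fun x hx => mul_pos hc (Real.rpow_pos_of_pos hx _)
  have hGpos : ∀ x > 0, ∀ᶠ n : ℕ in atTop, 0 < G (b n * x) := by
    intro x hx
    filter_upwards [(hG x hx).eventually (lt_mem_nhds (hlim_pos x hx))] with n hn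
    exact pos_of_mul_pos_right hn (Nat.cast_nonneg n)
  -- ratio limit along the sequence
  have hratio : ∀ x > 0, ∀ y > 0,
      Tendsto (fun n : ℕ => G (b n * x) / G (b n * y)) atTop (𝓝 (x ^ (-α) / y ^ (-α))) := by
    intro x hx y hy
    have h := (hG x hx).div (hG y hy) (hlim_pos y hy).ne'
    rw [mul_div_mul_left _ _ hc.ne'] at h
    refine h.congr' ?_
    filter_upwards [eventually_ge_atTop 1] with n hn
    have hn' : (n : ℝ) ≠ 0 := by
      have : n ≠ 0 := by omega
      exact_mod_cast this
    exact mul_div_mul_left _ _ hn'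
  -- the sequence is unbounded
  have hunb : ∀ x > 0, ∀ N : ℕ, 1 ≤ N → ∃ m, N ≤ m ∧ x < b m := by
    intro x hx N hN
    by_contra! hcon
    obtain ⟨K, hK, hK1⟩ := ((hGpos 1 one_pos).and (eventually_ge_atTop 1)).exists
    rw [mul_one] at hK
    have hz : 0 < b K / x := div_pos (hbpos K hK1) hx
    have hbd : ∀ᶠ n : ℕ in atTop, (n : ℝ) * G (b K) ≤ (n : ℝ) * G (b n * (b K / x)) := by
      filter_upwards [eventually_ge_atTop N] with n hn
      refine mul_le_mul_of_nonneg_left ?_ (Nat.cast_nonneg n)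
      refine hGanti (mul_pos (hbpos n (hN.trans hn)) hz) (hbpos K hK1) ?_
      calc b n * (b K / x) ≤ x * (b K / x) := by
            exact mul_le_mul_of_nonneg_right (hcon n hn) hz.le
        _ = b K := by field_simp
    have h1 : Tendsto (fun n : ℕ => (n : ℝ) * G (b K)) atTop atTop :=
      tendsto_natCast_atTop_atTop.atTop_mul_const hK
    exact not_tendsto_nhds_of_tendsto_atTop (tendsto_atTop_mono' _ hbd h1) _ (hG _ hz)
  -- consecutive terms are eventually comparable
  have hstep : ∀ r > 1, ∀ᶠ n : ℕ in atTop, b (n + 1) < b n * r := by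
    intro r hr
    have hr0 : (0 : ℝ) < r := by linarith
    have h1 := (hG 1 one_pos).comp (tendsto_add_atTop_nat 1)
    have h2 : Tendsto (fun n : ℕ => ((n : ℝ) + 1) * G (b n * r)) atTop (𝓝 (c * r ^ (-α))) := by
      have h0 : Tendsto (fun n : ℕ => G (b n * r)) atTop (𝓝 0) := by
        have h := (hG r hr0).mul (tendsto_inv_atTop_zero.comp tendsto_natCast_atTop_atTop)
        rw [mul_zero] at h
        refine h.congr' ?_
        filter_upwards [eventually_ge_atTop 1] with n hn
        have hn' : (n : ℝ) ≠ 0 := by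
          have : n ≠ 0 := by omega
          exact_mod_cast this
        simp only [Function.comp]
        field_simp
      have h := (hG r hr0).add h0
      rw [add_zero] at h
      refine h.congr (fun n => by ring)
    have hlt : c * r ^ (-α) < c * 1 ^ (-α) := by
      rw [Real.one_rpow]
      exact mul_lt_mul_of_pos_left (Real.rpow_lt_one_of_one_lt_of_neg hr (by linarith)) hc
    filter_upwards [h2.eventually_lt h1 hlt, eventually_ge_atTop 1] with n hn hn1
    by_contra! hcon
    simp only [Function.comp, mul_one, Nat.cast_add, Nat.cast_one] at hn
    have hle := hGanti (mul_pos (hbpos n hn1) hr0) (hbpos (n + 1) (by omega)) hcon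
    have : ((n : ℝ) + 1) * G (b (n + 1)) ≤ ((n : ℝ) + 1) * G (b n * r) :=
      mul_le_mul_of_nonneg_left hle (by positivity)
    linarith
  -- every large x is sandwiched
  have hsand : ∀ r > 1, ∀ P : ℕ → Prop, (∀ᶠ n in atTop, P n) →
      ∀ᶠ x in atTop, ∃ n, P n ∧ 0 < b n ∧ b n ≤ x ∧ x ≤ b n * r := by
    intro r hr P hP
    obtain ⟨N, hN⟩ := eventually_atTop.1 ((hP.and (hstep r hr)).and (eventually_ge_atTop 1))
    filter_upwards [eventually_ge_atTop (b N)] with x hx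
    have hN1 := (hN N le_rfl).2
    have hx0 : 0 < x := (hbpos N hN1).trans_le hx
    by_contra! hcon
    have hall : ∀ m, N ≤ m → b m ≤ x := by
      intro m hm
      induction m, hm using Nat.le_induction with
      | base => exact hx
      | succ m hm ih =>
        obtain ⟨⟨hp, hs⟩, h1⟩ := hN m hm
        exact (hs.trans (hcon m hp (hbpos m h1) ih)).le
    obtain ⟨m, hm, hm'⟩ := hunb x hx0 N hN1
    exact absurd (hall m hm) (not_le.2 hm')
  intro lam hlam
  have hcont : ∀ s : ℝ, Tendsto (fun r : ℝ => lam ^ (-α) * r ^ s) (𝓝[>] 1) (𝓝 (lam ^ (-α))) := by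
    intro s
    have h : ContinuousAt (fun r : ℝ => lam ^ (-α) * r ^ s) 1 :=
      continuousAt_const.mul (Real.continuousAt_rpow_const _ _ (Or.inl one_ne_zero))
    have h' := h.tendsto
    simp only [Real.one_rpow, mul_one] at h'
    exact h'.mono_left nhdsWithin_le_nhds
  rw [tendsto_order]
  constructor
  · intro l hl
    obtain ⟨r, hr, hr1⟩ := (((hcont (-α)).eventually (lt_mem_nhds hl)).and
      self_mem_nhdsWithin).exists
    have hr1 : 1 < r := hr1
    have hr0 : 0 < r := by linarith
    have hlr : 0 < lam * r := mul_pos hlam hr0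
    have hlim := hratio (lam * r) hlr 1 one_pos
    rw [Real.one_rpow, div_one, Real.mul_rpow hlam.le hr0.le] at hlim
    filter_upwards [hsand r hr1 _ ((hlim.eventually (lt_mem_nhds hr)).and (hGpos r hr0))]
      with x hx
    obtain ⟨n, ⟨hn, hg⟩, hbn, h1, h2⟩ := hx
    have hx0 : 0 < x := hbn.trans_le h1
    have hGx : 0 < G x := hg.trans_le (hGanti hx0 (mul_pos hbn hr0) h2)
    refine hn.trans_le ?_
    rw [mul_one]
    refine div_le_div₀ (hGnonneg _ (mul_pos hlam hx0)) ?_ hGx (hGanti hbn hx0 h1)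
    refine hGanti (mul_pos hlam hx0) (mul_pos hbn hlr) ?_
    calc lam * x ≤ lam * (b n * r) := mul_le_mul_of_nonneg_left h2 hlam.le
      _ = b n * (lam * r) := by ring
  · intro u hu
    obtain ⟨r, hr, hr1⟩ := (((hcont α).eventually (gt_mem_nhds hu)).and
      self_mem_nhdsWithin).exists
    have hr1 : 1 < r := hr1
    have hr0 : 0 < r := by linarith
    have hlim := hratio lam hlam r hr0
    rw [Real.rpow_neg hr0.le, div_inv_eq_mul] at hlim
    filter_upwards [hsand r hr1 _ ((hlim.eventually (gt_mem_nhds hr)).and (hGpos r hr0))]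
      with x hx
    obtain ⟨n, ⟨hn, hg⟩, hbn, h1, h2⟩ := hx
    have hx0 : 0 < x := hbn.trans_le h1
    refine lt_of_le_of_lt ?_ hn
    refine div_le_div₀ (hGnonneg _ (mul_pos hbn hlam)) ?_ hg (hGanti hx0 (mul_pos hbn hr0) h2)
    refine hGanti (mul_pos hbn hlam) (mul_pos hlam hx0) ?_
    rw [mul_comm]
    exact mul_le_mul_of_nonneg_left h1 hlam.le
end

section
/- Let α > 0 and let G : (0, ∞) → (0, ∞) be a nonincreasing function that is regularly varying of index −α at infinity, i.e., G(λx)/G(x) → λ^{−α} as x → ∞ for every λ > 0, and suppose G(x) → 0 as x → ∞. Define the generalized inverse G^{−1}(x) = inf{y : G(y) < x}. Then G(G^{−1}(x))/x → 1 as x → 0+. -/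
open Filter Topology

/-- for a nonincreasing, regularly varying (index `-α`) tail function `G`
with `G(x) → 0`, the generalized inverse `G⁻¹(x) = inf {y : G(y) < x}` satisfies
`G(G⁻¹(x))/x → 1` as `x → 0+`. -/
theorem tail_inverse_composition
    (α : ℝ) (hα : 0 < α)
    (G : ℝ → ℝ) (hGpos : ∀ x > 0, 0 < G x)
    (hGanti : AntitoneOn G (Set.Ioi 0))
    (hGrv : ∀ lam > 0, Tendsto (fun x => G (lam * x) / G x) atTop (𝓝 (lam ^ (-α))))
    (hG0 : Tendsto G atTop (𝓝 0)) :
    Tendsto (fun x => G (sInf {y | 0 < y ∧ G y < x}) / x) (𝓝[>] 0) (𝓝 1) := by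
  set t : ℝ → ℝ := fun x => sInf {y | 0 < y ∧ G y < x} with ht
  have hne : ∀ x > 0, ({y | 0 < y ∧ G y < x} : Set ℝ).Nonempty := by
    intro x hx
    obtain ⟨y, h1, h2⟩ := ((hG0.eventually_lt_const hx).and (eventually_gt_atTop 0)).exists
    exact ⟨y, h2, h1⟩
  have hbdd : ∀ x, BddBelow ({y | 0 < y ∧ G y < x} : Set ℝ) := fun x => ⟨0, fun y hy => hy.1.le⟩
  have htop : Tendsto t (𝓝[>] 0) atTop := by
    rw [tendsto_atTop]
    intro M
    have hM : (0 : ℝ) < max M 1 := lt_max_of_lt_right one_pos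
    have hev : ∀ᶠ x in 𝓝[>] (0 : ℝ), x < G (max M 1) :=
      (tendsto_nhdsWithin_of_tendsto_nhds tendsto_id).eventually_lt_const (hGpos _ hM)
    filter_upwards [hev, self_mem_nhdsWithin] with x hx hx0
    refine (le_max_left M 1).trans (le_csInf (hne x hx0) ?_)
    intro y hy
    by_contra! h
    have := hGanti (Set.mem_Ioi.2 hy.1) (Set.mem_Ioi.2 hM) h.le
    linarith [hy.2]
  have hcont : Tendsto (fun l : ℝ => (l ^ (-α))⁻¹) (𝓝 1) (𝓝 1) := by
    have h : ContinuousAt (fun l : ℝ => (l ^ (-α))⁻¹) 1 :=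
      (Real.continuousAt_rpow_const 1 (-α) (Or.inl one_ne_zero)).inv₀ (by simp)
    simpa [ContinuousAt] using h
  have hlim : ∀ l > 0, Tendsto (fun x => (G (l * t x) / G (t x))⁻¹) (𝓝[>] 0)
      (𝓝 ((l ^ (-α))⁻¹)) := fun l hl =>
    ((hGrv l hl).comp htop).inv₀ (Real.rpow_pos_of_pos hl _).ne'
  rw [tendsto_order]
  constructor
  · intro a ha
    have h1 : ∀ᶠ l in 𝓝[<] (1 : ℝ), a < (l ^ (-α))⁻¹ :=
      (tendsto_nhdsWithin_of_tendsto_nhds hcont).eventually_const_lt ha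
    have h2 : ∀ᶠ l in 𝓝[<] (1 : ℝ), 0 < l :=
      (tendsto_nhdsWithin_of_tendsto_nhds tendsto_id).eventually_const_lt one_pos
    have h3 : ∀ᶠ l in 𝓝[<] (1 : ℝ), l < 1 := self_mem_nhdsWithin
    obtain ⟨l, hl, hl0, hl1⟩ := (h1.and (h2.and h3)).exists
    filter_upwards [(hlim l hl0).eventually_const_lt hl, htop.eventually_gt_atTop 0,
      self_mem_nhdsWithin] with x hx htx hx0
    have hx0 : 0 < x := hx0
    refine hx.trans_le ?_
    rw [inv_div]
    have hle : x ≤ G (l * t x) := by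
      by_contra! h
      have := csInf_le (hbdd x) (show l * t x ∈ {y | 0 < y ∧ G y < x} from ⟨mul_pos hl0 htx, h⟩)
      change t x ≤ l * t x at this
      nlinarith
    exact div_le_div_of_nonneg_left (hGpos _ htx).le hx0 hle
  · intro a ha
    have h1 : ∀ᶠ l in 𝓝[>] (1 : ℝ), (l ^ (-α))⁻¹ < a :=
      (tendsto_nhdsWithin_of_tendsto_nhds hcont).eventually_lt_const ha
    have h3 : ∀ᶠ l in 𝓝[>] (1 : ℝ), 1 < l := self_mem_nhdsWithin
    obtain ⟨l, hl, hl1⟩ := (h1.and h3).exists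
    have hl0 : 0 < l := one_pos.trans hl1
    filter_upwards [(hlim l hl0).eventually_lt_const hl, htop.eventually_gt_atTop 0,
      self_mem_nhdsWithin] with x hx htx hx0
    have hx0 : 0 < x := hx0
    refine lt_of_le_of_lt ?_ hx
    rw [inv_div]
    have hle : G (l * t x) ≤ x := by
      have hlt : t x < l * t x := by nlinarith
      obtain ⟨y, hy, hyl⟩ := exists_lt_of_csInf_lt (hne x hx0) hlt
      exact (hGanti (Set.mem_Ioi.2 hy.1) (Set.mem_Ioi.2 (mul_pos hl0 htx)) hyl.le).trans hy.2.le
    exact div_le_div_of_nonneg_left (hGpos _ htx).le (hGpos _ (mul_pos hl0 htx)) hle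
end

section
/- Let (S, 𝒮) be a complete separable metric space with its Borel σ-algebra, let (σ_n)_{n≥1} be a sequence of random probability measures on S (i.e., measurable maps from a probability space Ω to the space of Borel probability measures on S), and let σ be a (deterministic) Borel probability measure on S. If for every Borel set B ⊆ S with σ(∂B) = 0 one has σ_n(B) → σ(B) almost surely as n → ∞, then almost surely σ_n converges weakly to σ as n → ∞ (i.e., there is an event of probability 1 on which, for every bounded continuous f : S → ℝ, ∫ f dσ_n → ∫ f dσ). -/
open MeasureTheory Filter Topology

/-- if a sequence of random probability measures on a complete separable
metric space converges almost surely on every `σ`-continuity set to a probability measure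
`σ`, then almost surely it converges weakly to `σ`. -/
theorem random_measures_as_weak_convergence
    {S : Type*} [MetricSpace S] [CompleteSpace S] [TopologicalSpace.SeparableSpace S]
    [MeasurableSpace S] [BorelSpace S]
    {Ω : Type*} [MeasurableSpace Ω] (P : Measure Ω) [IsProbabilityMeasure P]
    (σn : ℕ → Ω → Measure S) (hprob : ∀ n ω, IsProbabilityMeasure (σn n ω))
    (hmeas : ∀ (n : ℕ) (B : Set S), MeasurableSet B → Measurable (fun ω => σn n ω B))
    (σ : Measure S) [IsProbabilityMeasure σ]
    (hconv : ∀ B : Set S, MeasurableSet B → σ (frontier B) = 0 →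
      ∀ᵐ ω ∂P, Tendsto (fun n : ℕ => (σn n ω B).toReal) atTop (𝓝 (σ B).toReal)) :
    ∀ᵐ ω ∂P, ∀ f : BoundedContinuousFunction S ℝ,
      Tendsto (fun n : ℕ => ∫ x, f x ∂(σn n ω)) atTop (𝓝 (∫ x, f x ∂σ)) := by
  classical
  have hne : Nonempty S := by
    by_contra h
    rw [not_nonempty_iff] at h
    have h1 : σ Set.univ = 1 := measure_univ
    rw [Set.eq_empty_of_isEmpty (Set.univ : Set S)] at h1
    simp at h1
  have : SecondCountableTopology S := UniformSpace.secondCountable_of_separable S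
  have hr : ∀ p : ℕ × ℕ, ∃ r ∈ Set.Ioo (1 / ((p.2 : ℝ) + 2)) (1 / ((p.2 : ℝ) + 1)),
      σ (frontier (Metric.thickening r {TopologicalSpace.denseSeq S p.1})) = 0 := fun p =>
    exists_null_frontier_thickening σ _
      (one_div_lt_one_div_of_lt (by positivity) (by linarith))
  choose r hr hr0 using hr
  simp only [Metric.thickening_singleton] at hr0
  set B : ℕ × ℕ → Set S := fun p => Metric.ball (TopologicalSpace.denseSeq S p.1) (r p) with hB
  have hBopen : ∀ p, IsOpen (B p) := fun p => Metric.isOpen_ball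
  have hC : ∀ F : Finset (ℕ × ℕ), MeasurableSet (⋂ p ∈ F, B p) := fun F =>
    (isOpen_biInter_finset fun p _ => hBopen p).measurableSet
  have hC0 : ∀ F : Finset (ℕ × ℕ), σ (frontier (⋂ p ∈ F, B p)) = 0 := by
    intro F
    induction F using Finset.induction_on with
    | empty => simp
    | insert a F _ ih =>
      rw [Finset.set_biInter_insert]
      refine measure_mono_null (frontier_inter_subset _ _) (measure_union_null ?_ ?_)
      · exact measure_mono_null Set.inter_subset_left (hr0 a)
      · exact measure_mono_null Set.inter_subset_right ih
  have hae : ∀ᵐ ω ∂P, ∀ F : Finset (ℕ × ℕ),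
      Tendsto (fun n : ℕ => (σn n ω (⋂ p ∈ F, B p)).toReal) atTop
        (𝓝 (σ (⋂ p ∈ F, B p)).toReal) :=
    ae_all_iff.2 fun F => hconv _ (hC F) (hC0 F)
  filter_upwards [hae] with ω hω
  let μs : ℕ → ProbabilityMeasure S := fun n => ⟨σn n ω, hprob n ω⟩
  let μ : ProbabilityMeasure S := ⟨σ, inferInstance⟩
  have key : Tendsto μs atTop (𝓝 μ) := by
    refine IsPiSystem.tendsto_probabilityMeasure_of_tendsto_of_mem
      (S := Set.range fun F : Finset (ℕ × ℕ) => ⋂ p ∈ F, B p) ?_ ?_ ?_ ?_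
    · rintro _ ⟨F, rfl⟩ _ ⟨G, rfl⟩ -
      exact ⟨F ∪ G, Finset.iInf_union⟩
    · rintro _ ⟨F, rfl⟩
      exact hC F
    · intro u hu x hx
      obtain ⟨ε, hε, hεu⟩ := Metric.isOpen_iff.1 hu x hx
      obtain ⟨j, hj⟩ := exists_nat_one_div_lt (half_pos hε)
      obtain ⟨i, hi⟩ := (TopologicalSpace.denseRange_denseSeq S).exists_dist_lt x
        (show (0 : ℝ) < 1 / ((j : ℝ) + 2) by positivity)
      have h1 := (hr (i, j)).1
      have h2 := (hr (i, j)).2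
      simp only at h1 h2
      refine ⟨B (i, j), ⟨{(i, j)}, by simp⟩, (hBopen _).mem_nhds ?_, ?_⟩
      · exact Metric.mem_ball.2 (hi.trans h1)
      · intro y hy
        apply hεu
        have hy' : dist y (TopologicalSpace.denseSeq S i) < r (i, j) := hy
        have := dist_triangle_right y x (TopologicalSpace.denseSeq S i)
        rw [Metric.mem_ball]
        linarith
    · rintro _ ⟨F, rfl⟩
      rw [← NNReal.tendsto_coe]
      exact hω F
  exact ProbabilityMeasure.tendsto_iff_forall_integral_tendsto.1 key
end
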